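/- Let δ, γ be nonzero ordinals, τ an ordinal, and Σ = ⟨S_β : β < τ⟩ a partition of δ*. Then ⟨L^{δ,γ}, ⟨I^{Σ,γ}_x⟩_{x∈L^{δ,γ}}⟩ is an indexed template; that is: (1) ∅ ∈ I^{Σ,γ}_x for every x; (2) each I^{Σ,γ}_x is closed under finite unions and finite intersections; (3) if z < x in L^{δ,γ} then z ∈ A for some A ∈ I^{Σ,γ}_x; (4) I^{Σ,γ}_x ⊆ I^{Σ,γ}_y whenever x < y; and (5) the family ⋃_{x∈L^{δ,γ}} I^{Σ,γ}_x ∪ {L^{δ,γ}} is well-founded by the strict subset relation. -/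

import Mathlib

open Ordinal Cardinal

abbrev SOrd : Type 1 := Ordinalᵒᵈ ⊕ₗ Ordinal

namespace SOrd
def neg (α : Ordinal) : SOrd := toLex (Sum.inl (OrderDual.toDual α))
def pos (α : Ordinal) : SOrd := toLex (Sum.inr α)
def IsPos (a : SOrd) : Prop := ∃ α : Ordinal, a = pos α
def val (a : SOrd) : Ordinal := Sum.elim (fun b => OrderDual.ofDual b) id (ofLex a)
end SOrd

def IsBetween (δ : Ordinal) (a : SOrd) : Prop := SOrd.neg δ < a ∧ a < SOrd.pos δ

def Lset (δ γ : Ordinal) : Set (List SOrd) :=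
  {x | x ≠ [] ∧ (∃ h : 0 < x.length, ∃ α < γ, x[0]'h = SOrd.pos α) ∧
    ∀ k, ∀ h : k < x.length, 0 < k → IsBetween δ (x[k]'h)}

def Llt (x y : List SOrd) : Prop :=
  (∃ k, ∃ hx : k < x.length, ∃ hy : k < y.length,
      x.take k = y.take k ∧ x[k]'hx < y[k]'hy) ∨
  (∃ hy : x.length < y.length, y.take x.length = x ∧ SOrd.IsPos (y[x.length]'hy)) ∨
  (∃ hx : y.length < x.length, x.take y.length = y ∧ ¬ SOrd.IsPos (x[y.length]'hx))

/-- `S` (as the indexed family `⟨S β : β < τ⟩`, where each `ξ ∈ S β` codes the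
negative ordinal `ξ*`) is a partition of `δ*`. -/
def IsPartition (δ τ : Ordinal) (S : Ordinal → Set Ordinal) : Prop :=
  (∀ β, S β ⊆ Set.Iio δ) ∧ (∀ β, τ ≤ β → S β = ∅) ∧ (∀ ξ, ξ < δ → ∃! β, ξ ∈ S β)

/-- `β^Σ(ξ*)`: the index of the piece of the partition containing `ξ*`. -/
noncomputable def colorOf (S : Ordinal → Set Ordinal) (ξ : Ordinal) : Ordinal :=
  sInf {β | ξ ∈ S β}

/-- The index set `r_x`. -/
def rIdx (τ : Ordinal) (x : List SOrd) : Set ℕ :=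
  {i | ∃ h : i < x.length, 2 ≤ i ∧ i % 2 = 0 ∧ x[i]'h < SOrd.pos τ}

/-- `Σ`-relevant sequences. -/
def Relevant (δ γ τ : Ordinal) (S : Ordinal → Set Ordinal) (x : List SOrd) : Prop :=
  x ∈ Lset δ γ ∧ 3 ≤ x.length ∧ x.length % 2 = 1 ∧
  (∀ i, ∀ h : i < x.length, (SOrd.IsPos (x[i]'h) ↔ i % 2 = 0)) ∧
  (∀ i ∈ rIdx τ x, ∀ j ∈ rIdx τ x, i < j →
    ∀ (hi : i - 1 < x.length) (hj : j - 1 < x.length),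
      colorOf S (x[j-1]'hj).val < colorOf S (x[i-1]'hi).val) ∧
  x.length - 1 ∈ rIdx τ x

/-- `J^{Σ,γ}_x = {z ∈ L^{δ,γ} : x↾(|x|-1) ≤ z < x}`. -/
def Jset (δ γ : Ordinal) (x : List SOrd) : Set (List SOrd) :=
  {z ∈ Lset δ γ | (z = x.take (x.length - 1) ∨ Llt (x.take (x.length - 1)) z) ∧ Llt z x}

/-- The initial segment `L^{δ,γ}_α = {z : z < ⟨α⟩}` (equal to `L^{δ,γ}` when `α = γ`). -/
def Lbelow (δ γ α : Ordinal) : Set (List SOrd) :=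
  {z ∈ Lset δ γ | Llt z [SOrd.pos α]}

/-- `L^{δ,γ}_x = {z ∈ L^{δ,γ} : z < x}`. -/
def Lx (δ γ : Ordinal) (x : List SOrd) : Set (List SOrd) :=
  {z ∈ Lset δ γ | Llt z x}

/-- The basic sets of `I^{Σ,γ}`. -/
def IsBasic (δ γ τ : Ordinal) (S : Ordinal → Set Ordinal) (B : Set (List SOrd)) : Prop :=
  (∃ α ≤ γ, B = Lbelow δ γ α) ∨
  (∃ x, Relevant δ γ τ S x ∧ B = Jset δ γ x) ∨
  (∃ z ∈ Lset δ γ, B = ({z} : Set (List SOrd)))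

/-- `I^{Σ,γ}`: finite unions of basic sets. -/
def Ifam (δ γ τ : Ordinal) (S : Ordinal → Set Ordinal) : Set (Set (List SOrd)) :=
  {A | ∃ E : Finset (Set (List SOrd)), (∀ B ∈ E, IsBasic δ γ τ S B) ∧
    A = ⋃ B ∈ E, (B : Set (List SOrd))}

/-- `I^{Σ,γ}_x = {A ⊆ L^{δ,γ}_x : A ∈ I^{Σ,γ}}`. -/
def Ix (δ γ τ : Ordinal) (S : Ordinal → Set Ordinal) (x : List SOrd) : Set (Set (List SOrd)) :=
  {A | A ⊆ Lx δ γ x ∧ A ∈ Ifam δ γ τ S}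

theorem wf_finite_unions {X : Type*} (F : Set (Set X)) (hint : ∀ A ∈ F, ∀ B ∈ F, A ∩ B ∈ F)
    (hwf : F.WellFoundedOn (· ⊂ ·)) :
    {A | ∃ E : Finset (Set X), (∀ B ∈ E, B ∈ F) ∧
      A = ⋃ B ∈ E, (B : Set X)}.WellFoundedOn (· ⊂ ·) := by
  classical
  haveI : WellFoundedLT F := ⟨hwf⟩
  let U : Finset F → Set X := fun E => ⋃ B ∈ E, B.1
  have hU : ∀ (E : Finset F) z, z ∈ U E ↔ ∃ B ∈ E, z ∈ B.1 := by
    intro E z; simp [U]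
  have key : ∀ E E' : Finset F, U E' ⊂ U E →
      ∃ E'' : Finset F, U E'' = U E' ∧ Multiset.IsDershowitzMannaLT E''.val E.val := by
    intro E E' hlt
    let G : Finset F := Finset.image₂ (fun A B : F => (⟨A.1 ∩ B.1, hint _ A.2 _ B.2⟩ : F)) E' E
    let M : Finset F := G.filter (fun A => Maximal (· ∈ G) A)
    have hM : ∀ A, A ∈ M ↔ Maximal (· ∈ G) A := by
      intro A
      simp only [M, Finset.mem_filter]
      exact ⟨fun h => h.2, fun h => ⟨h.1, h⟩⟩
    have hMU : U M = U E' := by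
      ext z
      rw [hU, hU]
      constructor
      · rintro ⟨B, hB, hz⟩
        have hB := ((hM B).1 hB).1
        obtain ⟨A, hA, C, hC, rfl⟩ := Finset.mem_image₂.1 hB
        exact ⟨A, hA, hz.1⟩
      · rintro ⟨B, hB, hz⟩
        obtain ⟨C, hC, hzC⟩ := (hU E z).1 (hlt.1 ((hU E' z).2 ⟨B, hB, hz⟩))
        have hG : (⟨B.1 ∩ C.1, hint _ B.2 _ C.2⟩ : F) ∈ G :=
          Finset.mem_image₂.2 ⟨B, hB, C, hC, rfl⟩
        obtain ⟨D, hD, hDm⟩ := G.exists_le_maximal hG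
        exact ⟨D, (hM D).2 hDm, hD ⟨hz, hzC⟩⟩
    refine ⟨M, hMU, (E ∩ M).val, (M \ E).val, (E \ M).val, ?_, ?_, ?_, ?_⟩
    · intro h
      have h' : E \ M = ∅ := Finset.val_eq_zero.1 h
      have h'' : E ⊆ M := Finset.sdiff_eq_empty_iff_subset.1 h'
      apply hlt.2
      rw [← hMU]
      intro z hz
      obtain ⟨B, hB, hz⟩ := (hU _ _).1 hz
      exact (hU _ _).2 ⟨B, h'' hB, hz⟩
    · have : Disjoint (E ∩ M) (M \ E) := by
        rw [Finset.disjoint_left]; intro a ha hb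
        simp at ha hb; exact hb.2 ha.1
      rw [← Finset.disjUnion_val _ _ this]
      congr 1
      ext a; simp; tauto
    · have : Disjoint (E ∩ M) (E \ M) := by
        rw [Finset.disjoint_left]; intro a ha hb
        simp at ha hb; exact hb.2 ha.2
      rw [← Finset.disjUnion_val _ _ this]
      congr 1
      ext a; simp; tauto
    · intro y hy
      have hy : y ∈ M \ E := hy
      rw [Finset.mem_sdiff] at hy
      have hym := (hM y).1 hy.1
      obtain ⟨A, hA, C, hC, rfl⟩ := Finset.mem_image₂.1 hym.1
      have hle : (⟨A.1 ∩ C.1, hint _ A.2 _ C.2⟩ : F) ≤ C := fun z hz => hz.2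
      have hne : (⟨A.1 ∩ C.1, hint _ A.2 _ C.2⟩ : F) ≠ C := by
        intro h; apply hy.2; rw [h]; exact hC
      have hl := lt_of_le_of_ne hle hne
      refine ⟨C, ?_, hl⟩
      change C ∈ E \ M
      rw [Finset.mem_sdiff]
      refine ⟨hC, fun hCM => ?_⟩
      exact absurd (hym.2 ((hM C).1 hCM).1 hle) (not_le_of_gt hl)
  have hrange : {A | ∃ E : Finset (Set X), (∀ B ∈ E, B ∈ F) ∧ A = ⋃ B ∈ E, (B : Set X)}
      ⊆ Set.range U := by
    rintro A ⟨E, hE, rfl⟩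
    refine ⟨E.subtype (· ∈ F), ?_⟩
    ext z
    rw [hU]
    simp only [Set.mem_iUnion, Finset.mem_subtype]
    constructor
    · rintro ⟨B, hB, hz⟩; exact ⟨B.1, hB, hz⟩
    · rintro ⟨B, hB, hz⟩; exact ⟨⟨B, hE B hB⟩, hB, hz⟩
  refine Set.WellFoundedOn.subset ?_ hrange
  have hacc : ∀ m : Multiset F, ∀ E : Finset F, E.val = m → ∀ h : U E ∈ Set.range U,
      Acc (fun a b : Set.range U => a.1 ⊂ b.1) ⟨U E, h⟩ := by
    intro m
    induction m using (Multiset.wellFounded_isDershowitzMannaLT (α := F)).induction with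
    | _ m ih =>
      rintro E rfl h
      constructor
      rintro ⟨_, E', rfl⟩ hlt
      obtain ⟨E'', h1, h2⟩ := key E E' hlt
      have := ih _ h2 E'' rfl ⟨E'', rfl⟩
      simpa only [h1] using this
  constructor
  rintro ⟨_, E, rfl⟩
  exact hacc _ E rfl _

theorem wf_image_measure {ι α W : Type*} [LT W] [WellFoundedLT W] (s : Set ι) (f : ι → α)
    (r : α → α → Prop) (m : ι → W) (h : ∀ i ∈ s, ∀ j ∈ s, r (f i) (f j) → m i < m j) :
    (f '' s).WellFoundedOn r := by
  rw [Set.wellFoundedOn_image]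
  have : WellFounded (fun a b : s => m a.1 < m b.1) := InvImage.wf (fun a : s => m a.1) wellFounded_lt
  exact Subrelation.wf (fun {a b} hab => h _ a.2 _ b.2 hab) this

namespace SOrd
theorem pos_lt_pos {a b : Ordinal} : pos a < pos b ↔ a < b := Sum.Lex.inr_lt_inr_iff
theorem neg_lt_neg {a b : Ordinal} : neg a < neg b ↔ b < a := Sum.Lex.inl_lt_inl_iff
theorem neg_lt_pos (a b : Ordinal) : neg a < pos b := Sum.Lex.inl_lt_inr _ _
theorem isPos_pos (a : Ordinal) : IsPos (pos a) := ⟨a, rfl⟩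
theorem cases (a : SOrd) : (∃ α, a = pos α) ∨ ∃ α, a = neg α := by
  rcases a with a | a
  · exact Or.inr ⟨a, rfl⟩
  · exact Or.inl ⟨a, rfl⟩
theorem not_isPos_neg (a : Ordinal) : ¬ IsPos (neg a) := by
  rintro ⟨b, h⟩
  exact absurd h (neg_lt_pos a b).ne
theorem IsPos.mono {a b : SOrd} (h : IsPos a) (hab : a ≤ b) : IsPos b := by
  obtain ⟨α, rfl⟩ := h
  rcases cases b with h | ⟨β, rfl⟩
  · exact h
  · exact absurd hab (not_le_of_gt (neg_lt_pos _ _))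
theorem val_pos (a : Ordinal) : (pos a).val = a := rfl
end SOrd

theorem Llt_nil_nil : ¬ Llt [] [] := by
  rintro (⟨k, h, _⟩ | ⟨h, _⟩ | ⟨h, _⟩) <;> simp at h

theorem Llt_nil_cons (b : SOrd) (m : List SOrd) : Llt [] (b :: m) ↔ b.IsPos := by
  constructor
  · rintro (⟨k, h, _⟩ | ⟨h, _, h2⟩ | ⟨h, _⟩)
    · simp at h
    · exact h2
    · simp at h
  · intro h
    exact Or.inr (Or.inl ⟨by simp, by simp, h⟩)

theorem Llt_cons_nil (b : SOrd) (m : List SOrd) : Llt (b :: m) [] ↔ ¬ b.IsPos := by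
  constructor
  · rintro (⟨k, _, h, _⟩ | ⟨h, _⟩ | ⟨h, _, h2⟩)
    · simp at h
    · simp at h
    · exact h2
  · intro h
    exact Or.inr (Or.inr ⟨by simp, by simp, h⟩)

theorem Llt_cons_cons (a b : SOrd) (l m : List SOrd) :
    Llt (a :: l) (b :: m) ↔ a < b ∨ (a = b ∧ Llt l m) := by
  constructor
  · rintro (⟨k, h1, h2, h3, h4⟩ | ⟨h1, h2, h3⟩ | ⟨h1, h2, h3⟩)
    · cases k with
      | zero => exact Or.inl h4
      | succ k =>
        simp only [List.take_succ_cons, List.cons.injEq] at h3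
        simp only [List.length_cons, add_lt_add_iff_right] at h1 h2
        exact Or.inr ⟨h3.1, Or.inl ⟨k, h1, h2, h3.2, by simpa using h4⟩⟩
    · simp only [List.length_cons, List.take_succ_cons, List.cons.injEq] at h2
      simp only [List.length_cons, add_lt_add_iff_right] at h1
      exact Or.inr ⟨h2.1.symm, Or.inr (Or.inl ⟨h1, h2.2, by simpa using h3⟩)⟩
    · simp only [List.length_cons, List.take_succ_cons, List.cons.injEq] at h2
      simp only [List.length_cons, add_lt_add_iff_right] at h1
      exact Or.inr ⟨h2.1, Or.inr (Or.inr ⟨h1, h2.2, by simpa using h3⟩)⟩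
  · rintro (h | ⟨rfl, (⟨k, h1, h2, h3, h4⟩ | ⟨h1, h2, h3⟩ | ⟨h1, h2, h3⟩)⟩)
    · exact Or.inl ⟨0, by simp, by simp, by simp, h⟩
    · exact Or.inl ⟨k + 1, by simpa using h1, by simpa using h2, by simpa using h3,
        by simpa using h4⟩
    · exact Or.inr (Or.inl ⟨by simpa using h1, by simpa using h2, by simpa using h3⟩)
    · exact Or.inr (Or.inr ⟨by simpa using h1, by simpa using h2, by simpa using h3⟩)

theorem Llt_trans : ∀ {x y z : List SOrd}, Llt x y → Llt y z → Llt x z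
  | [], [], _, h, _ => absurd h Llt_nil_nil
  | _, [], [], _, h => absurd h Llt_nil_nil
  | [], b :: m, [], h1, h2 => by
    rw [Llt_nil_cons] at h1; rw [Llt_cons_nil] at h2; exact absurd h1 h2
  | [], b :: m, c :: n, h1, h2 => by
    rw [Llt_nil_cons] at *; rw [Llt_cons_cons] at h2
    exact h1.mono (by rcases h2 with h | h; exacts [h.le, h.1.le])
  | a :: l, [], c :: n, h1, h2 => by
    rw [Llt_nil_cons] at h2; rw [Llt_cons_nil] at h1; rw [Llt_cons_cons]
    left
    by_contra h
    exact h1 (h2.mono (not_lt.1 h))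
  | a :: l, b :: m, [], h1, h2 => by
    rw [Llt_cons_nil] at *; rw [Llt_cons_cons] at h1
    exact fun h => h2 (h.mono (by rcases h1 with h | h; exacts [h.le, h.1.le]))
  | a :: l, b :: m, c :: n, h1, h2 => by
    rw [Llt_cons_cons] at *
    rcases h1 with h1 | ⟨rfl, h1⟩
    · rcases h2 with h2 | ⟨rfl, h2⟩
      · exact Or.inl (h1.trans h2)
      · exact Or.inl h1
    · rcases h2 with h2 | ⟨rfl, h2⟩
      · exact Or.inl h2
      · exact Or.inr ⟨rfl, Llt_trans h1 h2⟩

theorem Llt_append (p l m : List SOrd) : Llt (p ++ l) (p ++ m) ↔ Llt l m := by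
  induction p with
  | nil => rfl
  | cons a p ih => simp [Llt_cons_cons, ih]

/-- nonnegative continuations below `ξ` -/
def Qc (ξ : Ordinal) (w : List SOrd) : Prop := (w = [] ∨ Llt [] w) ∧ Llt w [SOrd.pos ξ]

theorem Qc_nil (ξ : Ordinal) : Qc ξ [] := ⟨Or.inl rfl, (Llt_nil_cons _ _).2 (SOrd.isPos_pos _)⟩

theorem Qc_cons (ξ : Ordinal) (c : SOrd) (w : List SOrd) :
    Qc ξ (c :: w) ↔ c.IsPos ∧ (c < SOrd.pos ξ ∨ (c = SOrd.pos ξ ∧ Llt w [])) := by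
  simp [Qc, Llt_nil_cons, Llt_cons_cons]

theorem Qc_mono {ξ η : Ordinal} (h : ξ ≤ η) {w : List SOrd} (hw : Qc ξ w) : Qc η w := by
  cases w with
  | nil => exact Qc_nil _
  | cons c w =>
    rcases h.eq_or_lt with rfl | h
    · exact hw
    rw [Qc_cons] at *
    refine ⟨hw.1, Or.inl ?_⟩
    have := SOrd.pos_lt_pos.2 h
    rcases hw.2 with h2 | h2
    · exact h2.trans this
    · rw [h2.1]; exact this

def Kset (δ γ : Ordinal) (p : List SOrd) (ξ : Ordinal) : Set (List SOrd) :=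
  {z ∈ Lset δ γ | ∃ w, z = p ++ w ∧ Qc ξ w}

theorem Kset_mono {δ γ : Ordinal} (p : List SOrd) {ξ η : Ordinal} (h : ξ ≤ η) :
    Kset δ γ p ξ ⊆ Kset δ γ p η := by
  rintro z ⟨hz, w, rfl, hw⟩
  exact ⟨hz, w, rfl, Qc_mono h hw⟩

theorem convex_cone (ξ : Ordinal) : ∀ (p z : List SOrd), (z = p ∨ Llt p z) →
    Llt z (p ++ [SOrd.pos ξ]) → ∃ w, z = p ++ w
  | [], z, _, _ => ⟨z, rfl⟩
  | a :: p, [], h1, h2 => by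
    rw [List.cons_append, Llt_nil_cons] at h2
    rcases h1 with h1 | h1
    · simp at h1
    · rw [Llt_cons_nil] at h1; exact absurd h2 h1
  | a :: p, b :: z, h1, h2 => by
    rw [List.cons_append, Llt_cons_cons] at h2
    rw [Llt_cons_cons, List.cons.injEq] at h1
    have hab : b = a := by
      apply le_antisymm
      · rcases h2 with h | h; exacts [h.le, h.1.le]
      · rcases h1 with h | h | h; exacts [h.1.ge, h.le, h.1.le]
    subst hab
    simp only [lt_self_iff_false, true_and, false_or] at h1 h2
    obtain ⟨w, rfl⟩ := convex_cone ξ p z h1 h2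
    exact ⟨w, rfl⟩

theorem Jset_eq (δ γ : Ordinal) (p : List SOrd) (ξ : Ordinal) :
    Jset δ γ (p ++ [SOrd.pos ξ]) = Kset δ γ p ξ := by
  have ht : (p ++ [SOrd.pos ξ]).take ((p ++ [SOrd.pos ξ]).length - 1) = p := by simp
  ext z
  simp only [Jset, Kset, Set.mem_setOf_eq, ht]
  refine and_congr_right fun _ => ?_
  constructor
  · rintro ⟨h1, h2⟩
    obtain ⟨w, rfl⟩ := convex_cone ξ p z h1 h2
    refine ⟨w, rfl, ?_, ?_⟩
    · rcases h1 with h1 | h1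
      · left; simpa using h1
      · right
        rwa [← Llt_append p, List.append_nil]
    · rwa [Llt_append] at h2
  · rintro ⟨w, rfl, h1, h2⟩
    refine ⟨?_, (Llt_append _ _ _).2 h2⟩
    rcases h1 with rfl | h1
    · simp
    · right
      rwa [← Llt_append p, List.append_nil] at h1

theorem Lset_cons {δ γ : Ordinal} {z : List SOrd} (hz : z ∈ Lset δ γ) :
    ∃ α < γ, ∃ w, z = SOrd.pos α :: w := by
  cases z with
  | nil => exact absurd rfl hz.1
  | cons a w =>
    obtain ⟨_, α, hα, h⟩ := hz.2.1
    exact ⟨α, hα, w, by simpa using h⟩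

theorem Lbelow_eq (δ γ α : Ordinal) : Lbelow δ γ α = Kset δ γ [] α := by
  ext z
  simp only [Lbelow, Kset, Set.mem_setOf_eq, List.nil_append]
  refine and_congr_right fun hz => ?_
  obtain ⟨β, _, w, rfl⟩ := Lset_cons hz
  simp [Qc, Llt_nil_cons, SOrd.isPos_pos]

theorem Lset_eq (δ γ : Ordinal) : Lset δ γ = Lbelow δ γ γ := by
  ext z
  simp only [Lbelow, Set.mem_setOf_eq, iff_self_and]
  intro hz
  obtain ⟨β, hβ, w, rfl⟩ := Lset_cons hz
  rw [Llt_cons_cons]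
  exact Or.inl (SOrd.pos_lt_pos.2 hβ)

def Alt : List SOrd → Prop
  | [] => True
  | [_] => False
  | a :: b :: p => a.IsPos ∧ ¬ b.IsPos ∧ Alt p

theorem Alt_of : ∀ p : List SOrd, p.length % 2 = 0 →
    (∀ i, ∀ h : i < p.length, ((p[i]'h).IsPos ↔ i % 2 = 0)) → Alt p
  | [], _, _ => trivial
  | [_], h, _ => by simp at h
  | a :: b :: p, h, hi => by
    refine ⟨(hi 0 (by simp)).2 rfl, fun hb => ?_, ?_⟩
    · have := (hi 1 (by simp)).1 hb
      simp at this
    · apply Alt_of p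
      · simp only [List.length_cons] at h; omega
      · intro i hip
        have := hi (i + 2) (by simpa using hip)
        simpa using this

theorem Alt_append : ∀ p r : List SOrd, Alt p → Alt (p ++ r) → Alt r
  | [], _, _, h => h
  | [_], _, h, _ => h.elim
  | _ :: _ :: p, r, h1, h2 => Alt_append p r h1.2.2 h2.2.2

/-- Comparable stems. -/
theorem Kset_inter_aux (δ γ : Ordinal) (p r : List SOrd) (ξ η : Ordinal) (hp : Alt p)
    (hq : Alt (p ++ r)) :
    Kset δ γ (p ++ r) η ⊆ Kset δ γ p ξ ∨ Kset δ γ p ξ ⊆ Kset δ γ (p ++ r) η ∨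
      Kset δ γ p ξ ∩ Kset δ γ (p ++ r) η = ∅ := by
  have hr := Alt_append p r hp hq
  match r, hr with
  | [], _ =>
    rw [List.append_nil]
    rcases le_total ξ η with h | h
    · exact Or.inr (Or.inl (Kset_mono p h))
    · exact Or.inl (Kset_mono p h)
  | [_], h => exact h.elim
  | c :: d :: r, ⟨hc, hd, _⟩ =>
    rcases lt_or_ge (SOrd.pos ξ) c with h | h
    · right; right
      rw [Set.eq_empty_iff_forall_notMem]
      rintro z ⟨⟨_, w, rfl, hw⟩, ⟨_, w', h', hw'⟩⟩
      rw [List.append_assoc, List.append_cancel_left_eq] at h'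
      subst h'
      rw [List.cons_append, Qc_cons] at hw
      rcases hw.2 with h2 | h2
      · exact lt_asymm h h2
      · exact h.ne h2.1.symm
    · left
      rintro z ⟨hz, w, rfl, hw⟩
      refine ⟨hz, _, List.append_assoc _ _ _, ?_⟩
      rw [List.cons_append, Qc_cons, List.cons_append, Llt_cons_nil]
      refine ⟨hc, ?_⟩
      rcases h.lt_or_eq with h | h
      · exact Or.inl h
      · exact Or.inr ⟨h, hd⟩

theorem Kset_laminar (δ γ : Ordinal) (p q : List SOrd) (ξ η : Ordinal) (hp : Alt p) (hq : Alt q) :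
    Kset δ γ q η ⊆ Kset δ γ p ξ ∨ Kset δ γ p ξ ⊆ Kset δ γ q η ∨
      Kset δ γ p ξ ∩ Kset δ γ q η = ∅ := by
  by_cases h : ∃ z, z ∈ Kset δ γ p ξ ∩ Kset δ γ q η
  · obtain ⟨z, ⟨_, w, rfl, hw⟩, ⟨_, w', h, hw'⟩⟩ := h
    rw [List.append_eq_append_iff] at h
    rcases h with ⟨r, rfl, _⟩ | ⟨r, rfl, _⟩
    · exact Kset_inter_aux δ γ p r ξ η hp hq
    · rcases Kset_inter_aux δ γ q r η ξ hq hp with h | h | h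
      · exact Or.inr (Or.inl h)
      · exact Or.inl h
      · rw [Set.inter_comm] at h; exact Or.inr (Or.inr h)
  · right; right
    rw [Set.eq_empty_iff_forall_notMem]
    exact fun z hz => h ⟨z, hz⟩

theorem Relevant_decomp {δ γ τ : Ordinal} {S : Ordinal → Set Ordinal} {x : List SOrd}
    (h : Relevant δ γ τ S x) : ∃ p ξ, x = p ++ [SOrd.pos ξ] ∧ Alt p ∧ p ≠ [] ∧ p ∈ Lset δ γ ∧
      ξ < τ := by
  obtain ⟨hL, h3, hodd, hpos, hdec, hlast⟩ := h
  obtain ⟨hl, _, heven, hlt⟩ := hlast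
  obtain ⟨ξ, hξ⟩ := (hpos _ hl).2 heven
  rw [hξ, SOrd.pos_lt_pos] at hlt
  rcases List.eq_nil_or_concat x with rfl | ⟨p, a, rfl⟩
  · simp at h3
  simp only [List.concat_eq_append] at *
  have ha : a = SOrd.pos ξ := by simpa using hξ
  subst ha
  simp only [List.length_append, List.length_singleton] at h3 hodd
  refine ⟨p, ξ, rfl, Alt_of p (by omega) ?_, ?_, ⟨?_, ⟨by omega, ?_⟩, ?_⟩, hlt⟩
  · intro i hi
    have := hpos i (by simp; omega)
    rwa [List.getElem_append_left hi] at this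
  · rintro rfl; simp at h3
  · rintro rfl; simp at h3
  · obtain ⟨h0, α, hα, h⟩ := hL.2.1
    rw [List.getElem_append_left (by omega)] at h
    exact ⟨α, hα, h⟩
  · intro k hk hk0
    have := hL.2.2 k (by simp; omega) hk0
    rwa [List.getElem_append_left hk] at this

def Fbasic (δ γ τ : Ordinal) (S : Ordinal → Set Ordinal) : Set (Set (List SOrd)) :=
  {B | IsBasic δ γ τ S B ∨ B = ∅}

theorem Fbasic_cases {δ γ τ : Ordinal} {S : Ordinal → Set Ordinal} {B : Set (List SOrd)}
    (h : B ∈ Fbasic δ γ τ S) : B.Subsingleton ∨ ∃ p ξ, Alt p ∧ B = Kset δ γ p ξ := by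
  rcases h with (⟨α, _, rfl⟩ | ⟨x, hx, rfl⟩ | ⟨z, _, rfl⟩) | rfl
  · exact Or.inr ⟨[], α, trivial, Lbelow_eq _ _ _⟩
  · obtain ⟨p, ξ, rfl, hp, _⟩ := Relevant_decomp hx
    exact Or.inr ⟨p, ξ, hp, Jset_eq _ _ _ _⟩
  · exact Or.inl Set.subsingleton_singleton
  · exact Or.inl Set.subsingleton_empty

theorem subsingleton_laminar {X : Type*} (A B : Set X) (h : A.Subsingleton) :
    A ⊆ B ∨ A ∩ B = ∅ := by
  by_cases hAB : ∃ z, z ∈ A ∩ B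
  · obtain ⟨z, hzA, hzB⟩ := hAB
    left
    intro w hw
    rwa [h hw hzA]
  · right
    rw [Set.eq_empty_iff_forall_notMem]
    exact fun z hz => hAB ⟨z, hz⟩

theorem Fbasic_inter (δ γ τ : Ordinal) (S : Ordinal → Set Ordinal) :
    ∀ A ∈ Fbasic δ γ τ S, ∀ B ∈ Fbasic δ γ τ S, A ∩ B ∈ Fbasic δ γ τ S := by
  intro A hA B hB
  have : B ⊆ A ∨ A ⊆ B ∨ A ∩ B = ∅ := by
    rcases Fbasic_cases hA with h | ⟨p, ξ, hp, h⟩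
    · exact Or.inr (subsingleton_laminar A B h)
    · rcases Fbasic_cases hB with h' | ⟨q, η, hq, h'⟩
      · have := subsingleton_laminar B A h'
        rw [Set.inter_comm] at this
        tauto
      · rw [h, h']; exact Kset_laminar _ _ _ _ _ _ hp hq
  rcases this with h | h | h
  · rwa [Set.inter_eq_right.2 h]
  · rwa [Set.inter_eq_left.2 h]
  · rw [h]; exact Or.inr rfl

theorem Ifam_iff {δ γ τ : Ordinal} {S : Ordinal → Set Ordinal} {A : Set (List SOrd)} :
    A ∈ Ifam δ γ τ S ↔ ∃ E : Finset (Set (List SOrd)), (∀ B ∈ E, B ∈ Fbasic δ γ τ S) ∧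
      A = ⋃ B ∈ E, (B : Set (List SOrd)) := by
  classical
  constructor
  · rintro ⟨E, hE, rfl⟩
    exact ⟨E, fun B hB => Or.inl (hE B hB), rfl⟩
  · rintro ⟨E, hE, rfl⟩
    refine ⟨E.erase ∅, fun B hB => ?_, ?_⟩
    · rw [Finset.mem_erase] at hB
      exact (hE B hB.2).resolve_right hB.1
    · ext z
      simp only [Set.mem_iUnion, Finset.mem_erase]
      constructor
      · rintro ⟨B, hB, hz⟩
        exact ⟨B, ⟨by rintro rfl; exact hz, hB⟩, hz⟩
      · rintro ⟨B, hB, hz⟩; exact ⟨B, hB.2, hz⟩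

theorem Ifam_inter {δ γ τ : Ordinal} {S : Ordinal → Set Ordinal} {A B : Set (List SOrd)}
    (hA : A ∈ Ifam δ γ τ S) (hB : B ∈ Ifam δ γ τ S) : A ∩ B ∈ Ifam δ γ τ S := by
  classical
  rw [Ifam_iff] at *
  obtain ⟨E, hE, rfl⟩ := hA
  obtain ⟨E', hE', rfl⟩ := hB
  refine ⟨Finset.image₂ (· ∩ ·) E E', ?_, ?_⟩
  · intro C hC
    obtain ⟨A, hA, B, hB, rfl⟩ := Finset.mem_image₂.1 hC
    exact Fbasic_inter _ _ _ _ _ (hE A hA) _ (hE' B hB)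
  · ext z
    simp only [Set.mem_inter_iff, Set.mem_iUnion, Finset.mem_image₂]
    constructor
    · rintro ⟨⟨A, hA, hz⟩, ⟨B, hB, hz'⟩⟩
      exact ⟨A ∩ B, ⟨A, hA, B, hB, rfl⟩, hz, hz'⟩
    · rintro ⟨_, ⟨A, hA, B, hB, rfl⟩, hz, hz'⟩
      exact ⟨⟨A, hA, hz⟩, ⟨B, hB, hz'⟩⟩

theorem Ifam_union {δ γ τ : Ordinal} {S : Ordinal → Set Ordinal} {A B : Set (List SOrd)}
    (hA : A ∈ Ifam δ γ τ S) (hB : B ∈ Ifam δ γ τ S) : A ∪ B ∈ Ifam δ γ τ S := by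
  classical
  obtain ⟨E, hE, rfl⟩ := hA
  obtain ⟨E', hE', rfl⟩ := hB
  refine ⟨E ∪ E', ?_, ?_⟩
  · intro C hC
    rcases Finset.mem_union.1 hC with h | h
    exacts [hE C h, hE' C h]
  · rw [Finset.set_biUnion_union]

theorem Ifam_basic {δ γ τ : Ordinal} {S : Ordinal → Set Ordinal} {B : Set (List SOrd)}
    (h : IsBasic δ γ τ S B) : B ∈ Ifam δ γ τ S :=
  ⟨{B}, by simpa using h, by simp⟩

noncomputable def Jmeasure (S : Ordinal → Set Ordinal) (x : List SOrd) : Ordinal ×ₗ Ordinal :=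
  toLex (colorOf S ((x[x.length - 2]?).getD (SOrd.pos 0)).val,
    ((x[x.length - 1]?).getD (SOrd.pos 0)).val)

theorem Jmeasure_lt {δ γ τ : Ordinal} {S : Ordinal → Set Ordinal} {x y : List SOrd}
    (hx : Relevant δ γ τ S x) (hy : Relevant δ γ τ S y) (h : Jset δ γ y ⊂ Jset δ γ x) :
    Jmeasure S y < Jmeasure S x := by
  obtain ⟨p, ξ, rfl, hp, hp0, hpL, hξ⟩ := Relevant_decomp hx
  obtain ⟨q, η, rfl, hq, hq0, hqL, hη⟩ := Relevant_decomp hy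
  rw [Jset_eq, Jset_eq] at h
  have hmem : q ∈ Kset δ γ q η := ⟨hqL, [], by simp, Qc_nil _⟩
  obtain ⟨_, w, rfl, hw⟩ := h.1 hmem
  have hxl := hx.2.1
  have hxo := hx.2.2.1
  have hyl := hy.2.1
  have hyo := hy.2.2.1
  simp only [List.length_append, List.length_singleton] at hxl hxo hyl hyo
  rw [Jmeasure, Jmeasure, Prod.Lex.toLex_lt_toLex]
  cases w with
  | nil =>
    right
    simp only [List.append_nil] at h ⊢
    constructor
    · simp
      rw [List.getElem_append_left (by omega), List.getElem_append_left (by omega)]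
    · simp only [List.length_append, List.length_singleton, Nat.add_sub_cancel]
      simp [SOrd.val_pos]
      by_contra hc
      exact h.2 (Kset_mono p (not_lt.1 hc))
  | cons c w =>
    left
    rw [Qc_cons] at hw
    have hcτ : c < SOrd.pos τ := by
      have := SOrd.pos_lt_pos.2 hξ
      rcases hw.2 with h2 | h2
      · exact h2.trans this
      · rw [h2.1]; exact this
    have hi : p.length ∈ rIdx τ (p ++ c :: w ++ [SOrd.pos η]) := by
      refine ⟨by simp, by omega, by omega, ?_⟩
      simpa using hcτ
    have hj := hy.2.2.2.2.2
    have hdec := hy.2.2.2.2.1 _ hi _ hj (by simp) (by simp; omega) (by simp)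
    have e1 : (p ++ c :: w ++ [SOrd.pos η])[p.length - 1]'(by simp; omega) =
        p[p.length - 1]'(by omega) := by
      simp only [List.append_assoc]
      rw [List.getElem_append_left]
    rw [e1] at hdec
    have e2 : (p ++ [SOrd.pos ξ])[(p ++ [SOrd.pos ξ]).length - 2]? =
        some (p[p.length - 1]'(by omega)) := by
      have : (p ++ [SOrd.pos ξ]).length - 2 = p.length - 1 := by simp
      rw [this, List.getElem?_append_left (by omega), List.getElem?_eq_getElem]
    have e3 : (p ++ c :: w ++ [SOrd.pos η])[(p ++ c :: w ++ [SOrd.pos η]).length - 2]? =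
        some ((p ++ c :: w ++ [SOrd.pos η])[(p ++ c :: w ++ [SOrd.pos η]).length - 1 - 1]'(by
          simp)) := by
      rw [List.getElem?_eq_getElem (by simp)]
      rfl
    simp only [e2, e3, Option.getD_some]
    exact hdec

theorem Fbasic_wf (δ γ τ : Ordinal) (S : Ordinal → Set Ordinal) :
    (Fbasic δ γ τ S).WellFoundedOn (· ⊂ ·) := by
  have h1 : ((fun α => Lbelow δ γ α) '' Set.univ).WellFoundedOn (· ⊂ ·) := by
    apply wf_image_measure _ _ _ (fun α : Ordinal => α)
    intro α _ β _ h
    by_contra hc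
    simp only [Lbelow_eq] at h
    exact h.2 (Kset_mono _ (not_lt.1 hc))
  have h2 : ((fun x => Jset δ γ x) '' {x | Relevant δ γ τ S x}).WellFoundedOn (· ⊂ ·) := by
    apply wf_image_measure _ _ _ (Jmeasure S)
    intro x hx y hy h
    exact Jmeasure_lt hy hx h
  have h3 : ((fun z : List SOrd => ({z} : Set (List SOrd))) '' Set.univ).WellFoundedOn
      (· ⊂ ·) := by
    apply wf_image_measure _ _ _ (fun _ => 0 : List SOrd → ℕ)
    intro x _ y _ h
    have := Set.ssubset_singleton_iff.1 h
    simp at this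
  have h4 : ((fun _ : Unit => (∅ : Set (List SOrd))) '' Set.univ).WellFoundedOn (· ⊂ ·) := by
    apply wf_image_measure _ _ _ (fun _ => 0 : Unit → ℕ)
    intro x _ y _ h
    exact absurd h (ssubset_irrefl _)
  refine (((h1.union h2).union h3).union h4).subset ?_
  rintro B ((⟨α, _, rfl⟩ | ⟨x, hx, rfl⟩ | ⟨z, _, rfl⟩) | rfl)
  · exact Or.inl (Or.inl (Or.inl ⟨α, trivial, rfl⟩))
  · exact Or.inl (Or.inl (Or.inr ⟨x, hx, rfl⟩))
  · exact Or.inl (Or.inr ⟨z, trivial, rfl⟩)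
  · exact Or.inr ⟨(), trivial, rfl⟩

/-- `⟨L^{δ,γ}, ⟨I^{Σ,γ}_x⟩⟩` is an indexed template: (1) `∅ ∈ I^{Σ,γ}_x`;
(2) each `I^{Σ,γ}_x` is closed under finite unions and intersections;
(3) if `z < x` then `z ∈ A` for some `A ∈ I^{Σ,γ}_x`; (4) `I^{Σ,γ}_x ⊆ I^{Σ,γ}_y`
whenever `x < y`; (5) `⋃_x I^{Σ,γ}_x ∪ {L^{δ,γ}}` is well-founded by `⊊`. -/
theorem shelah_template_isIndexedTemplate (δ γ τ : Ordinal) (hδ : δ ≠ 0) (hγ : γ ≠ 0)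
    (S : Ordinal → Set Ordinal) (hS : IsPartition δ τ S) :
    (∀ x ∈ Lset δ γ, ∅ ∈ Ix δ γ τ S x) ∧
    (∀ x ∈ Lset δ γ, ∀ A ∈ Ix δ γ τ S x, ∀ B ∈ Ix δ γ τ S x,
        A ∪ B ∈ Ix δ γ τ S x ∧ A ∩ B ∈ Ix δ γ τ S x) ∧
    (∀ x ∈ Lset δ γ, ∀ z ∈ Lset δ γ, Llt z x → ∃ A ∈ Ix δ γ τ S x, z ∈ A) ∧
    (∀ x ∈ Lset δ γ, ∀ y ∈ Lset δ γ, Llt x y → Ix δ γ τ S x ⊆ Ix δ γ τ S y) ∧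
    Set.WellFoundedOn ({A | ∃ x ∈ Lset δ γ, A ∈ Ix δ γ τ S x} ∪ {Lset δ γ})
      (· ⊂ ·) := by
  refine ⟨?_, ?_, ?_, ?_, ?_⟩
  · intro x _
    exact ⟨Set.empty_subset _, ∅, by simp, by simp⟩
  · rintro x _ A ⟨hA, hA'⟩ B ⟨hB, hB'⟩
    exact ⟨⟨Set.union_subset hA hB, Ifam_union hA' hB'⟩,
      ⟨Set.inter_subset_left.trans hA, Ifam_inter hA' hB'⟩⟩
  · intro x _ z hz hzx
    refine ⟨{z}, ⟨?_, Ifam_basic (Or.inr (Or.inr ⟨z, hz, rfl⟩))⟩, rfl⟩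
    rintro _ rfl
    exact ⟨hz, hzx⟩
  · rintro x _ y _ hxy A ⟨hA, hA'⟩
    exact ⟨fun z hz => ⟨(hA hz).1, Llt_trans (hA hz).2 hxy⟩, hA'⟩
  · refine (wf_finite_unions _ (Fbasic_inter δ γ τ S) (Fbasic_wf δ γ τ S)).subset ?_
    rintro A (⟨x, _, _, hA⟩ | hA)
    · exact Ifam_iff.1 hA
    · rw [Set.mem_singleton_iff] at hA
      rw [hA, Lset_eq]
      exact Ifam_iff.1 (Ifam_basic (Or.inl ⟨γ, le_rfl, rfl⟩))
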